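/- arXiv:2406.03862 — 4 statements merged into one kernel-verified Lean document; each statement's English description precedes it below -/
import Mathlib

section
/- (Lemma 1.) Assume R̄ takes values in [m, M̄] and C < min{m, m/(1−γ) − γ·M̄/(1−γ)}. Let ν* be a deterministic adversarial policy that is uniformly optimal for M̂, i.e. V̂_{ν*}(s) ≥ V̂_ν(s) for every state s and every deterministic adversarial policy ν. Then ν*(s) ∈ B(s) for all s, and for every state s and every deterministic adversarial policy ν with ν(s) ∈ B(s) for all s, Ṽ_{π∘ν*}(s) = V̂_{ν*}(s) ≥ Ṽ_{π∘ν}(s); that is, ν* maximizes the expected discounted R̄-return of the composite policy π∘ν, simultaneously from every initial state, over all deterministic adversarial policies respecting B. -/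
open scoped BigOperators ENNReal

/-- A probability mass function on a finite type, as a real-valued function. -/
def IsPMF {X : Type*} [Fintype X] (q : X → ℝ) : Prop :=
  (∀ x, 0 ≤ q x) ∧ ∑ x, q x = 1

/-- The composite policy `π∘ν`: `(π∘ν)(a|s) = Σ_ŝ ν(ŝ|s) π(a|ŝ)`. -/
def comp {S A : Type*} [Fintype S] (π : S → A → ℝ) (ν : S → S → ℝ) : S → A → ℝ :=
  fun s a => ∑ sh, ν s sh * π sh a

/-- Time-`t` state distribution of policy `π` with transitions `p`, started from `d0`. -/
def stateDist {S A : Type*} [Fintype S] [Fintype A] (π : S → A → ℝ)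
    (p : S → A → S → ℝ) (d0 : S → ℝ) : ℕ → S → ℝ
  | 0 => d0
  | (t + 1) => fun s' => ∑ s, stateDist π p d0 t s * ∑ a, π s a * p s a s'

/-- Expected one-step reward from state distribution `d`. -/
def stepReward {S A : Type*} [Fintype S] [Fintype A] (π : S → A → ℝ)
    (p : S → A → S → ℝ) (R : S → A → S → ℝ) (d : S → ℝ) : ℝ :=
  ∑ s, d s * ∑ a, π s a * ∑ s', p s a s' * R s a s'

/-- Expected discounted return `E[Σ_t γ^t R(s_t,a_t,s_{t+1})]` started from distribution `d0`. -/
noncomputable def valueFrom {S A : Type*} [Fintype S] [Fintype A] (γ : ℝ)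
    (π : S → A → ℝ) (p : S → A → S → ℝ) (R : S → A → S → ℝ) (d0 : S → ℝ) : ℝ :=
  ∑' t : ℕ, γ ^ t * stepReward π p R (stateDist π p d0 t)

/-- Value function: expected discounted return started from state `s0`. -/
noncomputable def value {S A : Type*} [Fintype S] [Fintype A] [DecidableEq S] (γ : ℝ)
    (π : S → A → ℝ) (p : S → A → S → ℝ) (R : S → A → S → ℝ) (s0 : S) : ℝ :=
  valueFrom γ π p R (fun x => if x = s0 then 1 else 0)

/-- Transition kernel of the constructed MDP `M̂`: `p̂(s'|s,ŝ) = Σ_a π(a|ŝ) p(s'|s,a)`. -/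
def phat {S A : Type*} [Fintype A] (π : S → A → ℝ) (p : S → A → S → ℝ) :
    S → S → S → ℝ :=
  fun s sh s' => ∑ a, π sh a * p s a s'

/-- The point-mass (deterministic) adversarial policy associated to `f : S → S`. -/
def detPol {S : Type*} [DecidableEq S] (f : S → S) : S → S → ℝ :=
  fun s sh => if sh = f s then 1 else 0

open Classical in
/-- Kullback–Leibler divergence of finite pmfs, `+∞` when not absolutely continuous. -/
noncomputable def KL {X : Type*} [Fintype X] (P Q : X → ℝ) : ℝ≥0∞ :=
  if ∀ x, 0 < P x → 0 < Q x then ENNReal.ofReal (∑ x, P x * Real.log (P x / Q x)) else ⊤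

/-- Normalized discounted state distribution `d_π = (1-γ) Σ_t γ^t d_π^t`. -/
noncomputable def dDisc {S A : Type*} [Fintype S] [Fintype A] (γ : ℝ) (π : S → A → ℝ)
    (p : S → A → S → ℝ) (p0 : S → ℝ) : S → ℝ :=
  fun s => (1 - γ) * ∑' t : ℕ, γ ^ t * stateDist π p p0 t s

/-- Normalized discounted state–action distribution `ρ_π(s,a) = d_π(s) π(a|s)`. -/
noncomputable def rho {S A : Type*} [Fintype S] [Fintype A] (γ : ℝ) (π : S → A → ℝ)
    (p : S → A → S → ℝ) (p0 : S → ℝ) : S × A → ℝ :=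
  fun z => dDisc γ π p p0 z.1 * π z.1 z.2

/-- Unnormalized occupancy measure `ρ̂_π(s,a) = Σ_t γ^t Pr(s_t=s, a_t=a)`. -/
noncomputable def occ {S A : Type*} [Fintype S] [Fintype A] (γ : ℝ) (π : S → A → ℝ)
    (p : S → A → S → ℝ) (p0 : S → ℝ) : S × A → ℝ :=
  fun z => ∑' t : ℕ, γ ^ t * (stateDist π p p0 t z.1 * π z.1 z.2)

/-- Expected discounted cost `E_π[c] = Σ_{s,a} ρ̂_π(s,a) c(s,a)`. -/
noncomputable def Ecost {S A : Type*} [Fintype S] [Fintype A] (γ : ℝ) (π : S → A → ℝ)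
    (p : S → A → S → ℝ) (p0 : S → ℝ) (c : S × A → ℝ) : ℝ :=
  ∑ z : S × A, occ γ π p p0 z * c z

/-- Convex conjugate of `ψ` restricted to the set `C`. -/
noncomputable def psiStar {X : Type*} [Fintype X] (C : Set ((X → ℝ))) (ψ : (X → ℝ) → ℝ)
    (x : X → ℝ) : ℝ :=
  sSup ((fun c => (∑ z, x z * c z) - ψ c) '' C)


lemma aux_pmf {S A : Type*} [Fintype S] [Fintype A] (π : S → A → ℝ) (hπ : ∀ s, IsPMF (π s))
    (p : S → A → S → ℝ) (hp : ∀ s a, IsPMF (p s a)) (d0 : S → ℝ) (hd : IsPMF d0) (t : ℕ) :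
    IsPMF (stateDist π p d0 t) := by
  induction t with
  | zero => exact hd
  | succ t ih =>
    refine ⟨fun s' => ?_, ?_⟩
    · exact Finset.sum_nonneg fun s _ => mul_nonneg (ih.1 s)
        (Finset.sum_nonneg fun a _ => mul_nonneg ((hπ s).1 a) ((hp s a).1 s'))
    · simp only [stateDist]
      rw [Finset.sum_comm]
      rw [← ih.2]
      refine Finset.sum_congr rfl fun s _ => ?_
      rw [← Finset.mul_sum, Finset.sum_comm]
      simp only [← Finset.mul_sum, (hp s _).2, mul_one, (hπ s).2]

lemma aux_avg_le {X : Type*} [Fintype X] (q : X → ℝ) (hq : IsPMF q) (f : X → ℝ) (c : ℝ)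
    (h : ∀ x, f x ≤ c) : ∑ x, q x * f x ≤ c := by
  calc ∑ x, q x * f x ≤ ∑ x, q x * c :=
        Finset.sum_le_sum fun x _ => mul_le_mul_of_nonneg_left (h x) (hq.1 x)
    _ = c := by rw [← Finset.sum_mul, hq.2, one_mul]

lemma aux_le_avg {X : Type*} [Fintype X] (q : X → ℝ) (hq : IsPMF q) (f : X → ℝ) (c : ℝ)
    (h : ∀ x, c ≤ f x) : c ≤ ∑ x, q x * f x := by
  calc c = ∑ x, q x * c := by rw [← Finset.sum_mul, hq.2, one_mul]
    _ ≤ ∑ x, q x * f x :=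
        Finset.sum_le_sum fun x _ => mul_le_mul_of_nonneg_left (h x) (hq.1 x)

lemma aux_det {S : Type*} [Fintype S] [DecidableEq S] (f : S → S) (s : S) :
    IsPMF (detPol f s) := by
  refine ⟨fun x => ?_, ?_⟩
  · unfold detPol; split_ifs <;> norm_num
  · simp [detPol]

lemma aux_phat {S A : Type*} [Fintype S] [Fintype A] (π : S → A → ℝ) (hπ : ∀ s, IsPMF (π s))
    (p : S → A → S → ℝ) (hp : ∀ s a, IsPMF (p s a)) (s sh : S) : IsPMF (phat π p s sh) := by
  refine ⟨fun s' => Finset.sum_nonneg fun a _ => mul_nonneg ((hπ sh).1 a) ((hp s a).1 s'), ?_⟩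
  simp only [phat]
  rw [Finset.sum_comm]
  simp only [← Finset.mul_sum, (hp s _).2, mul_one, (hπ sh).2]

lemma aux_comp {S A : Type*} [Fintype S] [DecidableEq S] (π : S → A → ℝ) (f : S → S) (s : S)
    (a : A) : comp π (detPol f) s a = π (f s) a := by
  simp [comp, detPol]

lemma aux_step {S A : Type*} [Fintype S] [Fintype A] [DecidableEq S] (π : S → A → ℝ)
    (p : S → A → S → ℝ) (R : S → S → S → ℝ) (f : S → S) (d : S → ℝ) :
    stepReward (detPol f) (phat π p) R d
      = ∑ s, d s * ∑ s', phat π p s (f s) s' * R s (f s) s' := by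
  simp [stepReward, detPol]

lemma aux_dist {S A : Type*} [Fintype S] [Fintype A] [DecidableEq S] (π : S → A → ℝ)
    (p : S → A → S → ℝ) (f : S → S) (d : S → ℝ) (t : ℕ) :
    stateDist (comp π (detPol f)) p d t = stateDist (detPol f) (phat π p) d t := by
  induction t with
  | zero => rfl
  | succ t ih =>
    funext s'
    simp only [stateDist, ih, aux_comp]
    simp [detPol, phat]

/-- Lemma 1: a uniformly optimal deterministic adversarial policy `ν*` for `M̂`
respects `B`, and it maximizes the expected discounted `R̄`-return of the composite policy
`π∘ν`, simultaneously from every initial state, over all deterministic adversarial policies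
respecting `B`, with `Ṽ_{π∘ν*}(s) = V̂_{ν*}(s)`. -/
theorem stmt2 {S A : Type*} [Fintype S] [Fintype A] [Nonempty S] [Nonempty A] [DecidableEq S]
    (γ : ℝ) (hγ0 : 0 < γ) (hγ1 : γ < 1)
    (π : S → A → ℝ) (hπ : ∀ s, IsPMF (π s))
    (p : S → A → S → ℝ) (hp : ∀ s a, IsPMF (p s a))
    (B : S → Set S) (hB : ∀ s, (B s).Nonempty)
    (Rbar : S → A → S → ℝ) (m Mbar : ℝ)
    (hRl : ∀ s a s', m ≤ Rbar s a s') (hRu : ∀ s a s', Rbar s a s' ≤ Mbar)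
    (C : ℝ) (hC : C < min m (m / (1 - γ) - γ * Mbar / (1 - γ)))
    (Rhat : S → S → S → ℝ)
    (hRhat1 : ∀ s sh s', sh ∈ B s → 0 < phat π p s sh s' →
      Rhat s sh s' = (∑ a, π sh a * p s a s' * Rbar s a s') / phat π p s sh s')
    (hRhat2 : ∀ s sh s', sh ∉ B s → Rhat s sh s' = C)
    (νstar : S → S)
    (hopt : ∀ (ν : S → S) (s : S),
      value γ (detPol ν) (phat π p) Rhat s ≤ value γ (detPol νstar) (phat π p) Rhat s) :
    (∀ s, νstar s ∈ B s) ∧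
    (∀ s : S,
      value γ (comp π (detPol νstar)) p Rbar s = value γ (detPol νstar) (phat π p) Rhat s ∧
      ∀ ν : S → S, (∀ s', ν s' ∈ B s') →
        value γ (comp π (detPol ν)) p Rbar s ≤ value γ (detPol νstar) (phat π p) Rhat s) := by
  obtain ⟨hC1, hC2⟩ := lt_min_iff.1 hC
  obtain ⟨a0⟩ := ‹Nonempty A›
  have h1γ : 0 < 1 - γ := by linarith
  have hph := aux_phat π hπ p hp
  -- one-step reward identity for admissible actions
  have hr : ∀ s sh, sh ∈ B s → ∑ s', phat π p s sh s' * Rhat s sh s'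
      = ∑ a, π sh a * ∑ s', p s a s' * Rbar s a s' := by
    intro s sh hsh
    have h1 : ∀ s', phat π p s sh s' * Rhat s sh s' = ∑ a, π sh a * p s a s' * Rbar s a s' := by
      intro s'
      rcases ((hph s sh).1 s').lt_or_eq with h | h
      · rw [hRhat1 s sh s' hsh h, mul_div_cancel₀ _ h.ne']
      · rw [← h, zero_mul]
        symm
        refine Finset.sum_eq_zero fun a ha => ?_
        have h2 := (Finset.sum_eq_zero_iff_of_nonneg
          (fun a _ => mul_nonneg ((hπ sh).1 a) ((hp s a).1 s'))).1 h.symm a ha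
        rw [h2, zero_mul]
    simp only [h1]
    rw [Finset.sum_comm]
    simp only [Finset.mul_sum, mul_assoc]
  have hrC : ∀ s sh, sh ∉ B s → ∑ s', phat π p s sh s' * Rhat s sh s' = C := by
    intro s sh hsh
    simp only [hRhat2 s sh _ hsh]
    rw [← Finset.sum_mul, (hph s sh).2, one_mul]
  have hrl : ∀ s sh, sh ∈ B s → m ≤ ∑ s', phat π p s sh s' * Rhat s sh s' := by
    intro s sh hsh
    rw [hr s sh hsh]
    exact aux_le_avg _ (hπ sh) _ _ fun a => aux_le_avg _ (hp s a) _ _ fun s' => hRl s a s'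
  have hmM : ∀ _ : S, m ≤ Mbar := fun s => (hRl s a0 s).trans (hRu s a0 s)
  have hru : ∀ s sh, ∑ s', phat π p s sh s' * Rhat s sh s' ≤ Mbar := by
    intro s sh
    by_cases hsh : sh ∈ B s
    · rw [hr s sh hsh]
      exact aux_avg_le _ (hπ sh) _ _ fun a => aux_avg_le _ (hp s a) _ _ fun s' => hRu s a s'
    · rw [hrC s sh hsh]
      have := hmM s
      linarith
  have hrl' : ∀ s sh, C ≤ ∑ s', phat π p s sh s' * Rhat s sh s' := by
    intro s sh
    by_cases hsh : sh ∈ B s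
    · exact hC1.le.trans (hrl s sh hsh)
    · rw [hrC s sh hsh]
  have hdirac : ∀ s0 : S, IsPMF (fun x : S => if x = s0 then (1 : ℝ) else 0) := by
    intro s0
    refine ⟨fun x => ?_, by simp⟩
    dsimp only
    split_ifs <;> norm_num
  have hsd : ∀ (f : S → S) (s0 : S) t, IsPMF (stateDist (detPol f) (phat π p)
      (fun x => if x = s0 then 1 else 0) t) := fun f s0 t =>
    aux_pmf _ (aux_det f) _ hph _ (hdirac s0) t
  have hsum : ∀ (f : S → S) (s0 : S), Summable fun t : ℕ => γ ^ t *
      stepReward (detPol f) (phat π p) Rhat (stateDist (detPol f) (phat π p)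
      (fun x => if x = s0 then 1 else 0) t) := by
    intro f s0
    refine Summable.of_norm_bounded
      ((summable_geometric_of_lt_one hγ0.le hγ1).mul_right (max |C| |Mbar|)) fun t => ?_
    rw [norm_mul, Real.norm_of_nonneg (pow_nonneg hγ0.le t), Real.norm_eq_abs]
    refine mul_le_mul_of_nonneg_left ?_ (pow_nonneg hγ0.le t)
    rw [aux_step]
    refine abs_le_max_abs_abs ?_ ?_
    · exact aux_le_avg _ (hsd f s0 t) _ _ fun s => hrl' s _
    · exact aux_avg_le _ (hsd f s0 t) _ _ fun s => hru s _
  have hstar : ∀ s, νstar s ∈ B s := by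
    intro s
    by_contra hs
    choose f hf using hB
    have hlow : m / (1 - γ) ≤ value γ (detPol f) (phat π p) Rhat s := by
      have : m / (1 - γ) = ∑' t : ℕ, γ ^ t * m := by
        rw [tsum_mul_right, tsum_geometric_of_lt_one hγ0.le hγ1]; ring
      rw [this]
      refine Summable.tsum_le_tsum (fun t => ?_)
        ((summable_geometric_of_lt_one hγ0.le hγ1).mul_right m) (hsum f s)
      refine mul_le_mul_of_nonneg_left ?_ (pow_nonneg hγ0.le t)
      rw [aux_step]
      exact aux_le_avg _ (hsd f s t) _ _ fun x => hrl x _ (hf x)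
    have hup : value γ (detPol νstar) (phat π p) Rhat s ≤ C + γ * Mbar / (1 - γ) := by
      unfold value valueFrom
      rw [(hsum νstar s).tsum_eq_zero_add]
      have h0 : stepReward (detPol νstar) (phat π p) Rhat (stateDist (detPol νstar) (phat π p)
          (fun x => if x = s then 1 else 0) 0) = C := by
        rw [aux_step]
        simp [stateDist, hrC s _ hs]
      rw [h0, pow_zero, one_mul]
      have : γ * Mbar / (1 - γ) = ∑' t : ℕ, γ ^ t * (γ * Mbar) := by
        rw [tsum_mul_right, tsum_geometric_of_lt_one hγ0.le hγ1]; ring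
      rw [this]
      refine add_le_add le_rfl (Summable.tsum_le_tsum (fun t => ?_)
        ((summable_nat_add_iff 1).2 (hsum νstar s))
        ((summable_geometric_of_lt_one hγ0.le hγ1).mul_right _))
      rw [← mul_assoc, ← pow_succ]
      refine mul_le_mul_of_nonneg_left ?_ (pow_nonneg hγ0.le _)
      rw [aux_step]
      exact aux_avg_le _ (hsd νstar s _) _ _ fun x => hru x _
    have := hopt f s
    linarith
  have heq : ∀ (f : S → S), (∀ s, f s ∈ B s) → ∀ s,
      value γ (comp π (detPol f)) p Rbar s = value γ (detPol f) (phat π p) Rhat s := by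
    intro f hf s
    unfold value valueFrom
    refine tsum_congr fun t => ?_
    rw [aux_dist, aux_step]
    simp only [stepReward, aux_comp]
    congr 1
    refine Finset.sum_congr rfl fun x _ => ?_
    rw [hr x _ (hf x)]
  exact ⟨hstar, fun s => ⟨heq νstar hstar s, fun ν hν => (heq ν hν s).trans_le (hopt ν s)⟩⟩
end

section
/- (Theorem 1.) Let π_tgt : S → P(A) be a target policy, g : ℝ → ℝ, and d⋆ : S × A × S → ℝ a discriminator, and let 𝒟 be a divergence between policies for which there exists a constant c₀ such that, for every deterministic adversarial policy ν with ν(s) ∈ B(s) for all s, 𝒟(π∘ν, π_tgt) = E[Σ_{t≥0} γ^t g(d⋆(s_t, a_t, s_{t+1}))] + c₀, the expectation being over trajectories of the composite policy π∘ν in M started from p₀. Set R̄ = −g∘d⋆, assume R̄ takes values in [m, M̄], and let C < min{m, m/(1−γ) − γ·M̄/(1−γ)}. Then every deterministic adversarial policy ν* that is uniformly optimal for M̂ (i.e. V̂_{ν*}(s) ≥ V̂_ν(s) for all s and all deterministic ν) satisfies ν*(s) ∈ B(s) for all s, and ν* minimizes 𝒟(π∘ν, π_tgt) over all deterministic adversarial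 policies ν with ν(s) ∈ B(s) for all s. -/
open scoped BigOperators ENNReal

/-- one-step expected reward at a state -/
def rOf {S A : Type*} [Fintype S] [Fintype A] (π : S → A → ℝ)
    (p : S → A → S → ℝ) (R : S → A → S → ℝ) (s : S) : ℝ :=
  ∑ a, π s a * ∑ s', p s a s' * R s a s'

lemma stateDist_pmf {S A : Type*} [Fintype S] [Fintype A] (π : S → A → ℝ)
    (p : S → A → S → ℝ) (d0 : S → ℝ) (hπ : ∀ s, IsPMF (π s)) (hp : ∀ s a, IsPMF (p s a))
    (hd : IsPMF d0) (t : ℕ) : IsPMF (stateDist π p d0 t) := by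
  induction t with
  | zero => exact hd
  | succ t ih =>
    refine ⟨fun s' => ?_, ?_⟩
    · simp only [stateDist]
      exact Finset.sum_nonneg fun s _ => mul_nonneg (ih.1 s)
        (Finset.sum_nonneg fun a _ => mul_nonneg ((hπ s).1 a) ((hp s a).1 s'))
    · simp only [stateDist]
      rw [Finset.sum_comm]
      have : ∀ s, ∑ s', stateDist π p d0 t s * ∑ a, π s a * p s a s' = stateDist π p d0 t s := by
        intro s
        rw [← Finset.mul_sum, Finset.sum_comm]
        simp only [← Finset.mul_sum, (hp _ _).2, mul_one, (hπ s).2]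
      simp only [this, ih.2]

lemma pmf_avg_le {X : Type*} [Fintype X] (d r : X → ℝ) (hd : IsPMF d) (b : ℝ)
    (h : ∀ x, r x ≤ b) : ∑ x, d x * r x ≤ b := by
  calc ∑ x, d x * r x ≤ ∑ x, d x * b :=
        Finset.sum_le_sum fun x _ => mul_le_mul_of_nonneg_left (h x) (hd.1 x)
    _ = b := by rw [← Finset.sum_mul, hd.2, one_mul]

lemma le_pmf_avg {X : Type*} [Fintype X] (d r : X → ℝ) (hd : IsPMF d) (b : ℝ)
    (h : ∀ x, b ≤ r x) : b ≤ ∑ x, d x * r x := by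
  calc b = ∑ x, d x * b := by rw [← Finset.sum_mul, hd.2, one_mul]
    _ ≤ ∑ x, d x * r x :=
        Finset.sum_le_sum fun x _ => mul_le_mul_of_nonneg_left (h x) (hd.1 x)

lemma summable_value {S A : Type*} [Fintype S] [Fintype A] (γ : ℝ) (hγ0 : 0 < γ) (hγ1 : γ < 1)
    (π : S → A → ℝ)
    (p : S → A → S → ℝ) (R : S → A → S → ℝ) (d0 : S → ℝ) (hπ : ∀ s, IsPMF (π s))
    (hp : ∀ s a, IsPMF (p s a)) (hd : IsPMF d0) :
    Summable fun t : ℕ => γ ^ t * stepReward π p R (stateDist π p d0 t) := by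
  have hb : ∀ s, |rOf π p R s| ≤ ∑ x, |rOf π p R x| := fun s =>
    Finset.single_le_sum (f := fun x => |rOf π p R x|) (fun x _ => abs_nonneg _) (Finset.mem_univ s)
  refine Summable.of_norm_bounded (g := fun t : ℕ => γ ^ t * ∑ x, |rOf π p R x|)
    ((summable_geometric_of_lt_one hγ0.le hγ1).mul_right _) fun t => ?_
  have hD := stateDist_pmf π p d0 hπ hp hd t
  rw [norm_mul, Real.norm_of_nonneg (pow_nonneg hγ0.le t), Real.norm_eq_abs]
  refine mul_le_mul_of_nonneg_left (abs_le.2 ⟨?_, ?_⟩) (pow_nonneg hγ0.le t)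
  · exact le_pmf_avg _ (rOf π p R) hD _ fun s => (abs_le.1 (hb s)).1
  · exact pmf_avg_le _ (rOf π p R) hD _ fun s => (abs_le.1 (hb s)).2

lemma delta_pmf {S : Type*} [Fintype S] [DecidableEq S] (s0 : S) :
    IsPMF (fun x : S => if x = s0 then (1 : ℝ) else 0) := by
  refine ⟨fun x => ?_, by simp⟩
  dsimp only
  split_ifs <;> norm_num

lemma stateDist_lin {S A : Type*} [Fintype S] [Fintype A] [DecidableEq S] (π : S → A → ℝ)
    (p : S → A → S → ℝ) (d0 : S → ℝ) (t : ℕ) (s' : S) :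
    stateDist π p d0 t s' =
      ∑ s, d0 s * stateDist π p (fun x => if x = s then 1 else 0) t s' := by
  induction t generalizing s' with
  | zero => simp [stateDist]
  | succ t ih =>
    simp only [stateDist]
    simp_rw [ih, Finset.sum_mul, Finset.mul_sum (s := Finset.univ (α := S))]
    rw [Finset.sum_comm]
    simp only [mul_assoc]

lemma valueFrom_lin {S A : Type*} [Fintype S] [Fintype A] [DecidableEq S]
    (γ : ℝ) (hγ0 : 0 < γ) (hγ1 : γ < 1) (π : S → A → ℝ)
    (p : S → A → S → ℝ) (R : S → A → S → ℝ) (d0 : S → ℝ) (hπ : ∀ s, IsPMF (π s))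
    (hp : ∀ s a, IsPMF (p s a)) :
    valueFrom γ π p R d0 = ∑ s, d0 s * value γ π p R s := by
  simp only [value, valueFrom, ← tsum_mul_left]
  rw [← Summable.tsum_finsetSum]
  · refine tsum_congr fun t => ?_
    have : stepReward π p R (stateDist π p d0 t) = ∑ s, d0 s *
        stepReward π p R (stateDist π p (fun x => if x = s then 1 else 0) t) := by
      change ∑ x, stateDist π p d0 t x * rOf π p R x = ∑ s, d0 s *
        ∑ x, stateDist π p (fun x => if x = s then 1 else 0) t x * rOf π p R x
      simp_rw [stateDist_lin π p d0 t, Finset.sum_mul, Finset.mul_sum]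
      rw [Finset.sum_comm]
      simp only [mul_assoc]
    rw [this, Finset.mul_sum]
    exact Finset.sum_congr rfl fun s _ => by ring
  · intro s _
    exact (summable_value γ hγ0 hγ1 π p R _ hπ hp (delta_pmf s)).mul_left _

lemma phat_pmf {S A : Type*} [Fintype S] [Fintype A] (π : S → A → ℝ)
    (p : S → A → S → ℝ) (hπ : ∀ s, IsPMF (π s)) (hp : ∀ s a, IsPMF (p s a)) (s sh : S) :
    IsPMF (phat π p s sh) := by
  refine ⟨fun s' => Finset.sum_nonneg fun a _ => mul_nonneg ((hπ sh).1 a) ((hp s a).1 s'), ?_⟩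
  simp only [phat]
  rw [Finset.sum_comm]
  simp only [← Finset.mul_sum, (hp _ _).2, mul_one, (hπ sh).2]

lemma rOf_det {S : Type*} [Fintype S] [DecidableEq S] (ν : S → S)
    (q R : S → S → S → ℝ) (s : S) :
    rOf (detPol ν) q R s = ∑ s', q s (ν s) s' * R s (ν s) s' := by
  simp [rOf, detPol]

lemma comp_det {S A : Type*} [Fintype S] [DecidableEq S] (π : S → A → ℝ) (ν : S → S) (s : S)
    (a : A) : comp π (detPol ν) s a = π (ν s) a := by
  simp [comp, detPol]

lemma stateDist_comp {S A : Type*} [Fintype S] [Fintype A] [DecidableEq S] (π : S → A → ℝ)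
    (p : S → A → S → ℝ) (d0 : S → ℝ) (ν : S → S) (t : ℕ) :
    stateDist (comp π (detPol ν)) p d0 t = stateDist (detPol ν) (phat π p) d0 t := by
  induction t with
  | zero => rfl
  | succ t ih =>
    funext s'
    simp only [stateDist, ih, comp_det]
    simp [detPol, phat]

lemma rOf_inB {S A : Type*} [Fintype S] [Fintype A] [DecidableEq S] (π : S → A → ℝ)
    (p : S → A → S → ℝ) (hπ : ∀ s, IsPMF (π s)) (hp : ∀ s a, IsPMF (p s a)) (B : S → Set S)
    (Rbar : S → A → S → ℝ) (Rhat : S → S → S → ℝ)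
    (hRhat1 : ∀ s sh s', sh ∈ B s → 0 < phat π p s sh s' →
      Rhat s sh s' = (∑ a, π sh a * p s a s' * Rbar s a s') / phat π p s sh s')
    (ν : S → S) (s : S) (h : ν s ∈ B s) :
    rOf (detPol ν) (phat π p) Rhat s = ∑ a, π (ν s) a * ∑ s', p s a s' * Rbar s a s' := by
  rw [rOf_det]
  simp_rw [Finset.mul_sum]
  rw [Finset.sum_comm]
  refine Finset.sum_congr rfl fun s' _ => ?_
  simp only [← mul_assoc]
  rcases ((phat_pmf π p hπ hp s (ν s)).1 s').lt_or_eq with h0 | h0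
  · rw [hRhat1 s _ s' h h0, mul_div_cancel₀ _ h0.ne']
  · rw [← h0, zero_mul]
    symm
    have hz := (Finset.sum_eq_zero_iff_of_nonneg
      (fun a _ => mul_nonneg ((hπ (ν s)).1 a) ((hp s a).1 s'))).1 h0.symm
    exact Finset.sum_eq_zero fun a ha => by rw [hz a ha, zero_mul]

/-- Theorem 1: if the divergence `𝒟(π∘ν, π_tgt)` equals (up to an additive
constant) the expected discounted sum of `g(d⋆(s_t,a_t,s_{t+1}))` along trajectories of the
composite policy, and `R̄ = −g∘d⋆`, then every deterministic adversarial policy that is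
uniformly optimal for `M̂` respects `B` and minimizes the divergence over all deterministic
adversarial policies respecting `B`. -/
theorem stmt3 {S A : Type*} [Fintype S] [Fintype A] [Nonempty S] [Nonempty A] [DecidableEq S]
    (γ : ℝ) (hγ0 : 0 < γ) (hγ1 : γ < 1)
    (p0 : S → ℝ) (hp0 : IsPMF p0)
    (π : S → A → ℝ) (hπ : ∀ s, IsPMF (π s))
    (p : S → A → S → ℝ) (hp : ∀ s a, IsPMF (p s a))
    (B : S → Set S) (hB : ∀ s, (B s).Nonempty)
    (πtgt : S → A → ℝ) (hπtgt : ∀ s, IsPMF (πtgt s))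
    (g : ℝ → ℝ) (dstar : S → A → S → ℝ)
    (Div : (S → A → ℝ) → (S → A → ℝ) → ℝ) (c0 : ℝ)
    (hDiv : ∀ ν : S → S, (∀ s, ν s ∈ B s) →
      Div (comp π (detPol ν)) πtgt =
        valueFrom γ (comp π (detPol ν)) p (fun s a s' => g (dstar s a s')) p0 + c0)
    (Rbar : S → A → S → ℝ) (hRbar : ∀ s a s', Rbar s a s' = -(g (dstar s a s')))
    (m Mbar : ℝ)
    (hRl : ∀ s a s', m ≤ Rbar s a s') (hRu : ∀ s a s', Rbar s a s' ≤ Mbar)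
    (C : ℝ) (hC : C < min m (m / (1 - γ) - γ * Mbar / (1 - γ)))
    (Rhat : S → S → S → ℝ)
    (hRhat1 : ∀ s sh s', sh ∈ B s → 0 < phat π p s sh s' →
      Rhat s sh s' = (∑ a, π sh a * p s a s' * Rbar s a s') / phat π p s sh s')
    (hRhat2 : ∀ s sh s', sh ∉ B s → Rhat s sh s' = C)
    (νstar : S → S)
    (hopt : ∀ (ν : S → S) (s : S),
      value γ (detPol ν) (phat π p) Rhat s ≤ value γ (detPol νstar) (phat π p) Rhat s) :
    (∀ s, νstar s ∈ B s) ∧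
    (∀ ν : S → S, (∀ s, ν s ∈ B s) →
      Div (comp π (detPol νstar)) πtgt ≤ Div (comp π (detPol ν)) πtgt) := by
  have h1γ : 0 < 1 - γ := by linarith
  have hdet : ∀ (ν : S → S) s, IsPMF (detPol ν s) := fun ν s => delta_pmf (ν s)
  have hph := phat_pmf π p hπ hp
  obtain ⟨hCm, hCM⟩ := lt_min_iff.1 hC
  have hlo : ∀ (ν : S → S) s, ν s ∈ B s → m ≤ rOf (detPol ν) (phat π p) Rhat s := by
    intro ν s h
    rw [rOf_inB π p hπ hp B Rbar Rhat hRhat1 ν s h]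
    exact le_pmf_avg _ _ (hπ _) _ fun a => le_pmf_avg _ _ (hp s a) _ fun s' => hRl s a s'
  have hout : ∀ (ν : S → S) s, ν s ∉ B s → rOf (detPol ν) (phat π p) Rhat s = C := by
    intro ν s h
    rw [rOf_det]
    simp only [hRhat2 s _ _ h, ← Finset.sum_mul, (hph _ _).2, one_mul]
  have hmM : m ≤ Mbar :=
    have s := Classical.arbitrary S
    have a := Classical.arbitrary A
    (hRl s a s).trans (hRu s a s)
  have hhi : ∀ (ν : S → S) s, rOf (detPol ν) (phat π p) Rhat s ≤ Mbar := by
    intro ν s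
    by_cases h : ν s ∈ B s
    · rw [rOf_inB π p hπ hp B Rbar Rhat hRhat1 ν s h]
      exact pmf_avg_le _ _ (hπ _) _ fun a => pmf_avg_le _ _ (hp s a) _ fun s' => hRu s a s'
    · rw [hout ν s h]; linarith
  have hgeo := summable_geometric_of_lt_one hγ0.le hγ1
  have hgv := tsum_geometric_of_lt_one hγ0.le hγ1
  have hstar : ∀ s, νstar s ∈ B s := by
    by_contra! hcon
    obtain ⟨s0, hs0⟩ := hcon
    choose ν hν using hB
    have h1 : m / (1 - γ) ≤ value γ (detPol ν) (phat π p) Rhat s0 := by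
      have : m / (1 - γ) = ∑' t : ℕ, γ ^ t * m := by
        rw [tsum_mul_right, hgv]; ring
      rw [this]
      refine Summable.tsum_le_tsum (fun t => ?_) (hgeo.mul_right _)
        (summable_value γ hγ0 hγ1 _ _ Rhat _ (hdet ν) hph (delta_pmf s0))
      refine mul_le_mul_of_nonneg_left ?_ (pow_nonneg hγ0.le t)
      exact le_pmf_avg _ (rOf (detPol ν) (phat π p) Rhat)
        (stateDist_pmf _ _ _ (hdet ν) hph (delta_pmf s0) t) _ fun s => hlo ν s (hν s)
    have h2 : value γ (detPol νstar) (phat π p) Rhat s0 ≤ C + γ * Mbar / (1 - γ) := by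
      have hs := summable_value γ hγ0 hγ1 _ _ Rhat _ (hdet νstar) hph (delta_pmf s0)
      rw [value, valueFrom, hs.tsum_eq_zero_add]
      have e : γ * Mbar / (1 - γ) = ∑' t : ℕ, γ ^ t * (γ * Mbar) := by
        rw [tsum_mul_right, hgv]; ring
      have e0 : γ ^ 0 * stepReward (detPol νstar) (phat π p) Rhat
          (stateDist (detPol νstar) (phat π p) (fun x => if x = s0 then 1 else 0) 0) = C := by
        rw [← hout νstar s0 hs0, pow_zero, one_mul]
        change ∑ x, (if x = s0 then (1 : ℝ) else 0) * rOf (detPol νstar) (phat π p) Rhat x = _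
        simp
      rw [e0, e]
      refine add_le_add le_rfl ?_
      refine Summable.tsum_le_tsum (fun t => ?_) ((summable_nat_add_iff 1).2 hs)
        (hgeo.mul_right _)
      rw [pow_succ, mul_assoc]
      refine mul_le_mul_of_nonneg_left (mul_le_mul_of_nonneg_left ?_ hγ0.le)
        (pow_nonneg hγ0.le t)
      exact pmf_avg_le _ (rOf (detPol νstar) (phat π p) Rhat)
        (stateDist_pmf _ _ _ (hdet νstar) hph (delta_pmf s0) (t + 1)) _ fun s => hhi νstar s
    have := hopt ν s0
    linarith
  refine ⟨hstar, ?_⟩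
  have key : ∀ ν : S → S, (∀ s, ν s ∈ B s) → Div (comp π (detPol ν)) πtgt =
      -(∑ s, p0 s * value γ (detPol ν) (phat π p) Rhat s) + c0 := by
    intro ν hν
    rw [hDiv ν hν, ← valueFrom_lin γ hγ0 hγ1 _ _ _ _ (hdet ν) hph]
    congr 1
    rw [valueFrom, valueFrom, ← tsum_neg]
    refine tsum_congr fun t => ?_
    rw [← mul_neg]
    congr 1
    rw [stateDist_comp]
    change _ = -∑ x, _ * rOf (detPol ν) (phat π p) Rhat x
    rw [← Finset.sum_neg_distrib]
    refine Finset.sum_congr rfl fun x _ => ?_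
    rw [rOf_inB π p hπ hp B Rbar Rhat hRhat1 ν x (hν x), ← mul_neg]
    simp [comp_det, hRbar]
  intro ν hν
  rw [key ν hν, key νstar hstar]
  have : ∑ s, p0 s * value γ (detPol ν) (phat π p) Rhat s
      ≤ ∑ s, p0 s * value γ (detPol νstar) (phat π p) Rhat s :=
    Finset.sum_le_sum fun s _ => mul_le_mul_of_nonneg_left (hopt ν s) (hp0.1 s)
  linarith
end

section
/- Let π and π' be two policies on the same finite MDP, generating time-t state distributions d_π^t and d_{π'}^t from the common initial distribution p₀. Then for every t ≥ 1, D_KL(d_π^t ‖ d_{π'}^t) ≤ Σ_{j=0}^{t−1} E_{s∼d_π^j}[ D_KL( π(·|s) ‖ π'(·|s) ) ]. -/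
open scoped BigOperators ENNReal

theorem logsum_aux {I : Type*} [Fintype I] (u v : I → ℝ) (hu : ∀ i, 0 ≤ u i)
    (hv : ∀ i, 0 ≤ v i) (h : ∀ i, 0 < u i → 0 < v i) :
    (∑ i, u i) * Real.log ((∑ i, u i) / ∑ i, v i) ≤ ∑ i, u i * Real.log (u i / v i) := by
  rcases (Finset.sum_nonneg (fun i _ => hu i) : 0 ≤ ∑ i, u i).eq_or_lt with hU | hU
  · have h0 : ∀ i, u i = 0 := fun i =>
      (Finset.sum_eq_zero_iff_of_nonneg (fun i _ => hu i)).1 hU.symm i (Finset.mem_univ i)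
    simp [h0]
  · obtain ⟨i0, -, hi0⟩ := (Finset.sum_pos_iff_of_nonneg (fun i _ => hu i)).1 hU
    have hV : 0 < ∑ i, v i :=
      Finset.sum_pos' (fun i _ => hv i) ⟨i0, Finset.mem_univ _, h i0 hi0⟩
    set U := ∑ i, u i with hUd
    set V := ∑ i, v i with hVd
    have key : ∀ i, u i * Real.log (U / V) + u i - v i * (U / V) ≤ u i * Real.log (u i / v i) := by
      intro i
      rcases (hu i).eq_or_lt with h0 | h0
      · rw [← h0]
        have := mul_nonneg (hv i) (div_pos hU hV).le
        simp only [zero_mul]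
        linarith
      · have hvi := h i h0
        have hx : 0 < (v i * U) / (u i * V) := by positivity
        have h1 := Real.log_le_sub_one_of_pos hx
        rw [Real.log_div (by positivity) (by positivity), Real.log_mul hvi.ne' hU.ne',
          Real.log_mul h0.ne' hV.ne'] at h1
        rw [Real.log_div hU.ne' hV.ne', Real.log_div h0.ne' hvi.ne']
        have h2 := mul_le_mul_of_nonneg_left h1 h0.le
        have h3 : u i * ((v i * U) / (u i * V) - 1) = v i * (U / V) - u i := by
          field_simp
        rw [h3] at h2
        nlinarith
    have hs := Finset.sum_le_sum (fun i (_ : i ∈ Finset.univ) => key i)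
    rw [Finset.sum_sub_distrib, Finset.sum_add_distrib, ← Finset.sum_mul, ← Finset.sum_mul,
      ← hUd, ← hVd, mul_div_cancel₀ _ hV.ne'] at hs
    linarith

theorem stateDist_nonneg_aux {S A : Type*} [Fintype S] [Fintype A] (p0 : S → ℝ) (hp0 : IsPMF p0)
    (π : S → A → ℝ) (hπ : ∀ s, IsPMF (π s)) (p : S → A → S → ℝ) (hp : ∀ s a, IsPMF (p s a))
    (t : ℕ) : ∀ s, 0 ≤ stateDist π p p0 t s := by
  induction t with
  | zero => exact hp0.1
  | succ t ih =>
    intro s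
    exact Finset.sum_nonneg fun x _ => mul_nonneg (ih x)
      (Finset.sum_nonneg fun a _ => mul_nonneg ((hπ x).1 a) ((hp x a).1 s))

theorem step_aux {S A : Type*} [Fintype S] [Fintype A]
    (d e : S → ℝ) (hd : ∀ s, 0 ≤ d s) (he : ∀ s, 0 ≤ e s)
    (π π' : S → A → ℝ) (hπ : ∀ s, IsPMF (π s)) (hπ' : ∀ s, IsPMF (π' s))
    (p : S → A → S → ℝ) (hp : ∀ s a, IsPMF (p s a)) :
    KL (fun s' => ∑ s, d s * ∑ a, π s a * p s a s')
      (fun s' => ∑ s, e s * ∑ a, π' s a * p s a s') ≤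
      KL d e + ∑ s, ENNReal.ofReal (d s) * KL (π s) (π' s) := by
  classical
  by_cases hde : ∀ s, 0 < d s → 0 < e s
  swap
  · simp [KL, hde]
  by_cases hpp : ∀ s, 0 < d s → ∀ a, 0 < π s a → 0 < π' s a
  swap
  · push Not at hpp
    obtain ⟨s, hs, a, ha, hb⟩ := hpp
    have h1 : KL (π s) (π' s) = ⊤ := by
      rw [KL, if_neg]
      intro h
      exact absurd (h a ha) (not_lt.2 hb)
    have h2 : ∑ s, ENNReal.ofReal (d s) * KL (π s) (π' s) = ⊤ := by
      refine ENNReal.sum_eq_top.2 ⟨s, Finset.mem_univ _, ?_⟩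
      rw [h1, ENNReal.mul_top]
      simpa using hs
    rw [h2]; simp
  have hre : ∀ (d : S → ℝ) (π : S → A → ℝ) s', ∑ s, d s * ∑ a, π s a * p s a s'
      = ∑ z : S × A, d z.1 * π z.1 z.2 * p z.1 z.2 s' := by
    intro d π s'
    rw [Fintype.sum_prod_type]
    refine Finset.sum_congr rfl fun s _ => ?_
    rw [Finset.mul_sum]
    exact Finset.sum_congr rfl fun a _ => by ring
  simp only [hre]
  have hu : ∀ s' (z : S × A), 0 ≤ d z.1 * π z.1 z.2 * p z.1 z.2 s' := fun s' z =>
    mul_nonneg (mul_nonneg (hd _) ((hπ _).1 _)) ((hp _ _).1 _)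
  have hv : ∀ s' (z : S × A), 0 ≤ e z.1 * π' z.1 z.2 * p z.1 z.2 s' := fun s' z =>
    mul_nonneg (mul_nonneg (he _) ((hπ' _).1 _)) ((hp _ _).1 _)
  have hpos : ∀ s' (z : S × A), 0 < d z.1 * π z.1 z.2 * p z.1 z.2 s' →
      0 < d z.1 ∧ 0 < π z.1 z.2 ∧ 0 < p z.1 z.2 s' := by
    intro s' z h
    refine ⟨(hd _).lt_of_ne' ?_, ((hπ _).1 _).lt_of_ne' ?_, ((hp _ _).1 _).lt_of_ne' ?_⟩ <;>
    · intro h0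
      simp [h0] at h
  have huv : ∀ s' (z : S × A), 0 < d z.1 * π z.1 z.2 * p z.1 z.2 s' →
      0 < e z.1 * π' z.1 z.2 * p z.1 z.2 s' := by
    intro s' z h
    obtain ⟨h1, h2, h3⟩ := hpos s' z h
    exact mul_pos (mul_pos (hde _ h1) (hpp _ h1 _ h2)) h3
  have hac : ∀ s', 0 < ∑ z : S × A, d z.1 * π z.1 z.2 * p z.1 z.2 s' →
      0 < ∑ z : S × A, e z.1 * π' z.1 z.2 * p z.1 z.2 s' := by
    intro s' h
    obtain ⟨z, -, hz⟩ := (Finset.sum_pos_iff_of_nonneg (fun i _ => hu s' i)).1 h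
    exact Finset.sum_pos' (fun i _ => hv s' i) ⟨z, Finset.mem_univ _, huv s' z hz⟩
  have hreal : ∑ s', (∑ z : S × A, d z.1 * π z.1 z.2 * p z.1 z.2 s') *
      Real.log ((∑ z : S × A, d z.1 * π z.1 z.2 * p z.1 z.2 s') /
        ∑ z : S × A, e z.1 * π' z.1 z.2 * p z.1 z.2 s') ≤
      ∑ s, d s * Real.log (d s / e s) +
        ∑ s, d s * ∑ a, π s a * Real.log (π s a / π' s a) := by
    calc _ ≤ ∑ s', ∑ z : S × A, d z.1 * π z.1 z.2 * p z.1 z.2 s' *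
          Real.log (d z.1 * π z.1 z.2 * p z.1 z.2 s' / (e z.1 * π' z.1 z.2 * p z.1 z.2 s')) :=
          Finset.sum_le_sum fun s' _ => logsum_aux _ _ (hu s') (hv s') (huv s')
      _ = ∑ s', ∑ z : S × A, p z.1 z.2 s' * (d z.1 * π z.1 z.2 *
          (Real.log (d z.1 / e z.1) + Real.log (π z.1 z.2 / π' z.1 z.2))) := by
          refine Finset.sum_congr rfl fun s' _ => Finset.sum_congr rfl fun z _ => ?_
          rcases (hu s' z).eq_or_lt with h0 | h0
          · rw [← h0, zero_mul, ← mul_assoc, mul_comm (p _ _ _), ← h0, zero_mul]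
          · obtain ⟨h1, h2, h3⟩ := hpos s' z h0
            have h4 := hde _ h1
            have h5 := hpp _ h1 _ h2
            rw [mul_div_mul_right _ _ h3.ne', mul_div_mul_comm,
              Real.log_mul (by positivity) (by positivity)]
            ring
      _ = ∑ z : S × A, d z.1 * π z.1 z.2 *
          (Real.log (d z.1 / e z.1) + Real.log (π z.1 z.2 / π' z.1 z.2)) := by
          rw [Finset.sum_comm]
          refine Finset.sum_congr rfl fun z _ => ?_
          rw [← Finset.sum_mul, (hp _ _).2, one_mul]
      _ = _ := by
          rw [Fintype.sum_prod_type, ← Finset.sum_add_distrib]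
          refine Finset.sum_congr rfl fun s _ => ?_
          have : ∀ a, d s * π s a * (Real.log (d s / e s) + Real.log (π s a / π' s a)) =
            π s a * (d s * Real.log (d s / e s)) +
              d s * (π s a * Real.log (π s a / π' s a)) := fun a => by ring
          simp only [this]
          rw [Finset.sum_add_distrib, ← Finset.sum_mul, (hπ s).2, one_mul, Finset.mul_sum]
  rw [KL, if_pos hac, KL, if_pos hde]
  refine (ENNReal.ofReal_le_ofReal hreal).trans (ENNReal.ofReal_add_le.trans ?_)
  gcongr
  refine (Finset.le_sum_of_subadditive ENNReal.ofReal ENNReal.ofReal_zero.le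
    (fun _ _ => ENNReal.ofReal_add_le) _ _).trans (Finset.sum_le_sum fun s _ => ?_)
  rcases (hd s).eq_or_lt with h0 | h0
  · simp [← h0]
  · rw [KL, if_pos (hpp s h0), ENNReal.ofReal_mul h0.le]

/-- cumulative bound on the KL divergence between the time-`t` state
distributions of two policies started from the same initial distribution. -/
theorem stmt6 {S A : Type*} [Fintype S] [Fintype A] [Nonempty S] [Nonempty A]
    (p0 : S → ℝ) (hp0 : IsPMF p0)
    (π π' : S → A → ℝ) (hπ : ∀ s, IsPMF (π s)) (hπ' : ∀ s, IsPMF (π' s))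
    (p : S → A → S → ℝ) (hp : ∀ s a, IsPMF (p s a))
    (t : ℕ) (ht : 1 ≤ t) :
    KL (stateDist π p p0 t) (stateDist π' p p0 t) ≤
      ∑ j ∈ Finset.range t,
        ∑ s, ENNReal.ofReal (stateDist π p p0 j s) * KL (π s) (π' s) := by
  clear ht
  induction t with
  | zero =>
    have h : ∀ x, p0 x / p0 x = 0 ∨ p0 x / p0 x = 1 := fun x => by
      by_cases h : p0 x = 0
      · simp [h]
      · exact Or.inr (div_self h)
    have h2 : ∀ x, Real.log (p0 x / p0 x) = 0 := fun x => by
      rcases h x with h | h <;> simp [h]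
    simp [KL, stateDist, h2]
  | succ t ih =>
    rw [Finset.sum_range_succ]
    refine (step_aux _ _ (stateDist_nonneg_aux p0 hp0 π hπ p hp t)
      (stateDist_nonneg_aux p0 hp0 π' hπ' p hp t) π π' hπ hπ' p hp).trans ?_
    gcongr
end

section
/- Let π be a policy and ν an adversarial policy, with composite policy π∘ν. Then the KL divergence between the normalized discounted state–action distributions satisfies D_KL( ρ_π ‖ ρ_{π∘ν} ) ≤ (1/(1−γ²)) · Σ_{t≥0} γ^t · E_{s∼d_π^t}[ D_KL( π(·|s) ‖ (π∘ν)(·|s) ) ]. -/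
open scoped BigOperators ENNReal

lemma aux_term (x y c : ℝ) (hx : 0 ≤ x) (hy : 0 ≤ y) (hc : 0 < c) (h : 0 < x → 0 < y) :
    x * Real.log c + x - c * y ≤ x * Real.log (x / y) := by
  rcases hx.eq_or_lt with h0 | h0
  · subst h0; simp; positivity
  · have hy' := h h0
    have h1 := Real.log_le_sub_one_of_pos (show 0 < c * y / x by positivity)
    have h2 : Real.log (c * y / x) = Real.log c - Real.log (x / y) := by
      rw [Real.log_div (by positivity) (by positivity), Real.log_mul (by positivity) (by positivity),
        Real.log_div (by positivity) (by positivity)]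
      ring
    rw [h2] at h1
    have h3 := mul_le_mul_of_nonneg_left h1 hx
    have h4 : x * (c * y / x - 1) = c * y - x := by field_simp
    rw [h4] at h3
    linarith

lemma aux_logsum {ι : Type*} [Fintype ι] (x y : ι → ℝ) (hx : ∀ i, 0 ≤ x i) (hy : ∀ i, 0 ≤ y i)
    (h : ∀ i, 0 < x i → 0 < y i) :
    (∑ i, x i) * Real.log ((∑ i, x i) / ∑ i, y i) ≤ ∑ i, x i * Real.log (x i / y i) := by
  rcases (Finset.sum_nonneg (fun i _ => hx i) : 0 ≤ ∑ i, x i).eq_or_lt with h0 | h0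
  · have : ∀ i, x i = 0 := fun i =>
      (Finset.sum_eq_zero_iff_of_nonneg (fun i _ => hx i)).1 h0.symm i (Finset.mem_univ i)
    simp [this]
  · have hY : 0 < ∑ i, y i := by
      obtain ⟨i, _, hi⟩ := Finset.exists_ne_zero_of_sum_ne_zero h0.ne'
      exact Finset.sum_pos' (fun i _ => hy i)
        ⟨i, Finset.mem_univ i, h i (lt_of_le_of_ne (hx i) (Ne.symm hi))⟩
    have hc : 0 < (∑ i, x i) / ∑ i, y i := by positivity
    have := Finset.sum_le_sum (fun i (_ : i ∈ Finset.univ) =>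
      aux_term (x i) (y i) _ (hx i) (hy i) hc (h i))
    rw [Finset.sum_sub_distrib, Finset.sum_add_distrib, ← Finset.sum_mul, ← Finset.mul_sum,
      div_mul_cancel₀ _ hY.ne'] at this
    linarith

lemma comp_isPMF {S A : Type*} [Fintype S] [Fintype A] (π : S → A → ℝ) (hπ : ∀ s, IsPMF (π s))
    (ν : S → S → ℝ) (hν : ∀ s, IsPMF (ν s)) (s : S) : IsPMF (comp π ν s) := by
  refine ⟨fun a => Finset.sum_nonneg fun i _ => mul_nonneg ((hν s).1 i) ((hπ i).1 a), ?_⟩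
  unfold comp
  rw [Finset.sum_comm]
  simp_rw [← Finset.mul_sum, (hπ _).2, mul_one]
  exact (hν s).2

section
variable {S A : Type*} [Fintype S] [Fintype A]
    (γ : ℝ) (hγ0 : 0 < γ) (hγ1 : γ < 1)
    (p0 : S → ℝ) (hp0 : IsPMF p0)
    (π : S → A → ℝ) (hπ : ∀ s, IsPMF (π s))
    (p : S → A → S → ℝ) (hp : ∀ s a, IsPMF (p s a))

include hp0 hπ hp in
lemma stateDist_isPMF (t : ℕ) : IsPMF (stateDist π p p0 t) := by
  induction t with
  | zero => exact hp0
  | succ t ih =>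
    refine ⟨fun s' => Finset.sum_nonneg fun s _ => mul_nonneg (ih.1 s)
      (Finset.sum_nonneg fun a _ => mul_nonneg ((hπ s).1 a) ((hp s a).1 s')), ?_⟩
    simp only [stateDist]
    rw [Finset.sum_comm]
    simp_rw [← Finset.mul_sum]
    rw [← ih.2]
    refine Finset.sum_congr rfl fun s _ => ?_
    rw [Finset.sum_comm]
    simp_rw [← Finset.mul_sum, (hp _ _).2, mul_one, (hπ _).2, mul_one]

include hγ0 hγ1 hp0 hπ hp in
lemma aux_summable (s : S) : Summable fun t : ℕ => γ ^ t * stateDist π p p0 t s := by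
  refine Summable.of_nonneg_of_le (fun t => ?_) (fun t => ?_)
    (summable_geometric_of_lt_one hγ0.le hγ1)
  · exact mul_nonneg (by positivity) ((stateDist_isPMF p0 hp0 π hπ p hp t).1 s)
  · have hd := stateDist_isPMF p0 hp0 π hπ p hp t
    have : stateDist π p p0 t s ≤ 1 := by
      rw [← hd.2]
      exact Finset.single_le_sum (fun i _ => hd.1 i) (Finset.mem_univ s)
    exact mul_le_of_le_one_right (by positivity) this

include hγ0 hγ1 hp0 hπ hp in
lemma aux_dDisc_nonneg (s : S) : 0 ≤ dDisc γ π p p0 s :=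
  mul_nonneg (by linarith) (tsum_nonneg fun t => mul_nonneg (by positivity)
    ((stateDist_isPMF p0 hp0 π hπ p hp t).1 s))

include hγ0 hγ1 hp0 hπ hp in
lemma aux_dDisc_pos (s : S) (t : ℕ) (h : 0 < stateDist π p p0 t s) : 0 < dDisc γ π p p0 s :=
  mul_pos (by linarith) ((aux_summable γ hγ0 hγ1 p0 hp0 π hπ p hp s).tsum_pos
    (fun t => mul_nonneg (by positivity) ((stateDist_isPMF p0 hp0 π hπ p hp t).1 s)) t
    (mul_pos (by positivity) h))

include hp0 hπ hp in
lemma aux_exists (s : S) (h : 0 < dDisc γ π p p0 s) : ∃ t, 0 < stateDist π p p0 t s := by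
  by_contra! hc
  have : ∀ t, stateDist π p p0 t s = 0 := fun t =>
    le_antisymm (hc t) ((stateDist_isPMF p0 hp0 π hπ p hp t).1 s)
  simp [dDisc, this] at h

include hγ0 hγ1 hp0 hπ hp in
lemma aux_fix (s' : S) : dDisc γ π p p0 s' =
    ∑ o : Option (S × A), (match o with
      | none => (1 - γ) * p0 s'
      | some z => γ * (p z.1 z.2 s') * rho γ π p p0 z) := by
  rw [Fintype.sum_option]
  simp only [dDisc, rho]
  have hs := fun s => aux_summable γ hγ0 hγ1 p0 hp0 π hπ p hp s
  rw [(hs s').tsum_eq_zero_add]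
  have h1 : ∀ t, γ ^ (t + 1) * stateDist π p p0 (t + 1) s' =
      ∑ s, (γ ^ t * stateDist π p p0 t s) * (γ * ∑ a, π s a * p s a s') := by
    intro t
    simp only [stateDist, Finset.mul_sum, Finset.sum_mul]
    refine Finset.sum_congr rfl fun s _ => Finset.sum_congr rfl fun a _ => ?_
    ring
  simp_rw [h1]
  rw [Summable.tsum_finsetSum (fun s _ => (hs s).mul_right _)]
  simp_rw [tsum_mul_right]
  simp only [pow_zero, one_mul, stateDist]
  rw [mul_add, Fintype.sum_prod_type]
  simp only [Finset.mul_sum]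
  congr 1
  refine Finset.sum_congr rfl fun s _ => Finset.sum_congr rfl fun a _ => ?_
  ring

end

lemma ofReal_le_KL {X : Type*} [Fintype X] (P Q : X → ℝ) :
    ENNReal.ofReal (∑ x, P x * Real.log (P x / Q x)) ≤ KL P Q := by
  unfold KL
  split_ifs
  · exact le_rfl
  · exact le_top

lemma ofReal_sum_le' {X : Type*} (s : Finset X) (f : X → ℝ) :
    ENNReal.ofReal (∑ x ∈ s, f x) ≤ ∑ x ∈ s, ENNReal.ofReal (f x) := by
  classical
  induction s using Finset.induction_on with
  | empty => simp
  | insert a s ha ih =>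
    rw [Finset.sum_insert ha, Finset.sum_insert ha]
    exact ENNReal.ofReal_add_le.trans (by gcongr)

lemma aux_real {S A : Type*} [Fintype S] [Fintype A]
    (γ : ℝ) (hγ0 : 0 < γ) (hγ1 : γ < 1)
    (p0 : S → ℝ) (hp0 : IsPMF p0)
    (π π' : S → A → ℝ) (hπ : ∀ s, IsPMF (π s)) (hπ' : ∀ s, IsPMF (π' s))
    (p : S → A → S → ℝ) (hp : ∀ s a, IsPMF (p s a))
    (hd : ∀ s, 0 < dDisc γ π p p0 s → 0 < dDisc γ π' p p0 s)
    (hac : ∀ s, 0 < dDisc γ π p p0 s → ∀ a, 0 < π s a → 0 < π' s a) :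
    (1 - γ) * ∑ z, rho γ π p p0 z * Real.log (rho γ π p p0 z / rho γ π' p p0 z) ≤
      ∑ s, dDisc γ π p p0 s * ∑ a, π s a * Real.log (π s a / π' s a) := by
  have nd := aux_dDisc_nonneg γ hγ0 hγ1 p0 hp0 π hπ p hp
  have nd' := aux_dDisc_nonneg γ hγ0 hγ1 p0 hp0 π' hπ' p hp
  have nr : ∀ z, 0 ≤ rho γ π p p0 z := fun z => mul_nonneg (nd _) ((hπ _).1 _)
  have nr' : ∀ z, 0 ≤ rho γ π' p p0 z := fun z => mul_nonneg (nd' _) ((hπ' _).1 _)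
  have acr : ∀ z, 0 < rho γ π p p0 z → 0 < rho γ π' p p0 z := by
    intro z hz
    have h1 : 0 < dDisc γ π p p0 z.1 := pos_of_mul_pos_left hz ((hπ _).1 _)
    have h2 : 0 < π z.1 z.2 := pos_of_mul_pos_right hz (nd _)
    exact mul_pos (hd _ h1) (hac _ h1 _ h2)
  have chain : ∑ z, rho γ π p p0 z * Real.log (rho γ π p p0 z / rho γ π' p p0 z) =
      ∑ s, dDisc γ π p p0 s * Real.log (dDisc γ π p p0 s / dDisc γ π' p p0 s) +
      ∑ s, dDisc γ π p p0 s * ∑ a, π s a * Real.log (π s a / π' s a) := by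
    rw [Fintype.sum_prod_type, ← Finset.sum_add_distrib]
    refine Finset.sum_congr rfl fun s _ => ?_
    have : ∀ a, rho γ π p p0 (s, a) * Real.log (rho γ π p p0 (s, a) / rho γ π' p p0 (s, a)) =
        dDisc γ π p p0 s * Real.log (dDisc γ π p p0 s / dDisc γ π' p p0 s) * π s a +
        dDisc γ π p p0 s * (π s a * Real.log (π s a / π' s a)) := by
      intro a
      simp only [rho]
      rcases (nd s).eq_or_lt with h | h
      · simp [← h]
      rcases ((hπ s).1 a).eq_or_lt with h2 | h2
      · simp [← h2]
      have h3 := hd s h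
      have h4 := hac s h a h2
      rw [mul_div_mul_comm, Real.log_mul (by positivity) (by positivity)]
      ring
    simp_rw [this]
    rw [Finset.sum_add_distrib, ← Finset.mul_sum, ← Finset.mul_sum, (hπ s).2, mul_one]
  have key : ∑ s, dDisc γ π p p0 s * Real.log (dDisc γ π p p0 s / dDisc γ π' p p0 s) ≤
      γ * ∑ z, rho γ π p p0 z * Real.log (rho γ π p p0 z / rho γ π' p p0 z) := by
    have step : ∀ s', dDisc γ π p p0 s' * Real.log (dDisc γ π p p0 s' / dDisc γ π' p p0 s') ≤
        ∑ z, p z.1 z.2 s' *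
          (γ * (rho γ π p p0 z * Real.log (rho γ π p p0 z / rho γ π' p p0 z))) := by
      intro s'
      rw [aux_fix γ hγ0 hγ1 p0 hp0 π hπ p hp s', aux_fix γ hγ0 hγ1 p0 hp0 π' hπ' p hp s']
      refine (aux_logsum _ _ ?_ ?_ ?_).trans ?_
      · rintro (_ | z)
        · exact mul_nonneg (by linarith) (hp0.1 _)
        · exact mul_nonneg (mul_nonneg hγ0.le ((hp _ _).1 _)) (nr z)
      · rintro (_ | z)
        · exact mul_nonneg (by linarith) (hp0.1 _)
        · exact mul_nonneg (mul_nonneg hγ0.le ((hp _ _).1 _)) (nr' z)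
      · rintro (_ | z) h
        · exact h
        · have h1 := pos_of_mul_pos_left h (nr z)
          exact mul_pos h1 (acr z (pos_of_mul_pos_right h h1.le))
      · rw [Fintype.sum_option]
        have h0 : (1 - γ) * p0 s' * Real.log ((1 - γ) * p0 s' / ((1 - γ) * p0 s')) = 0 := by
          by_cases hz : (1 - γ) * p0 s' = 0
          · simp [hz]
          · simp [div_self hz]
        simp only [h0, zero_add]
        refine Finset.sum_le_sum fun z _ => le_of_eq ?_
        by_cases hz : p z.1 z.2 s' = 0
        · simp [hz]
        · rw [mul_div_mul_left _ _ (mul_ne_zero hγ0.ne' hz)]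
          ring
    refine (Finset.sum_le_sum fun s' _ => step s').trans (le_of_eq ?_)
    rw [Finset.sum_comm, Finset.mul_sum]
    refine Finset.sum_congr rfl fun z _ => ?_
    rw [← Finset.sum_mul, (hp _ _).2, one_mul]
  linarith

/-- KL divergence between the normalized discounted state–action distributions of
`π` and of the composite policy `π∘ν` is bounded by
`1/(1−γ²) · Σ_t γ^t · E_{s∼d_π^t}[KL(π(·|s) ‖ (π∘ν)(·|s))]`. -/
theorem stmt7 {S A : Type*} [Fintype S] [Fintype A] [Nonempty S] [Nonempty A]
    (γ : ℝ) (hγ0 : 0 < γ) (hγ1 : γ < 1)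
    (p0 : S → ℝ) (hp0 : IsPMF p0)
    (π : S → A → ℝ) (hπ : ∀ s, IsPMF (π s))
    (p : S → A → S → ℝ) (hp : ∀ s a, IsPMF (p s a))
    (ν : S → S → ℝ) (hν : ∀ s, IsPMF (ν s)) :
    KL (rho γ π p p0) (rho γ (comp π ν) p p0) ≤
      ENNReal.ofReal (1 / (1 - γ ^ 2)) *
        ∑' t : ℕ, ENNReal.ofReal (γ ^ t) *
          ∑ s, ENNReal.ofReal (stateDist π p p0 t s) * KL (π s) (comp π ν s) := by

  have hπ' := comp_isPMF π hπ ν hν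
  generalize comp π ν = π' at hπ' ⊢
  have hpm := stateDist_isPMF p0 hp0 π hπ p hp
  have hpm' := stateDist_isPMF p0 hp0 π' hπ' p hp
  have hg : 0 < 1 - γ := by linarith
  -- rewrite the sum
  have hsum : (∑' t : ℕ, ENNReal.ofReal (γ ^ t) *
      ∑ s, ENNReal.ofReal (stateDist π p p0 t s) * KL (π s) (π' s)) =
      ∑ s, ENNReal.ofReal (∑' t : ℕ, γ ^ t * stateDist π p p0 t s) * KL (π s) (π' s) := by
    simp_rw [Finset.mul_sum]
    rw [Summable.tsum_finsetSum (fun s _ => ENNReal.summable)]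
    refine Finset.sum_congr rfl fun s _ => ?_
    rw [ENNReal.ofReal_tsum_of_nonneg
      (fun t => mul_nonneg (by positivity) ((hpm t).1 s))
      (aux_summable γ hγ0 hγ1 p0 hp0 π hπ p hp s), ← ENNReal.tsum_mul_right]
    refine tsum_congr fun t => ?_
    rw [ENNReal.ofReal_mul (by positivity), mul_assoc]
  rw [hsum]
  have h1 : (1 : ℝ≥0∞) ≤ ENNReal.ofReal (1 / (1 - γ ^ 2)) := by
    rw [ENNReal.one_le_ofReal, one_le_div (by nlinarith)]
    nlinarith
  refine le_trans ?_ (le_mul_of_one_le_left zero_le h1)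
  by_cases htop : (∑ s, ENNReal.ofReal (∑' t : ℕ, γ ^ t * stateDist π p p0 t s) *
      KL (π s) (π' s)) = ⊤
  · rw [htop]; exact le_top
  have hac : ∀ s, 0 < dDisc γ π p p0 s → ∀ a, 0 < π s a → 0 < π' s a := by
    intro s hs
    by_contra hcon
    apply htop
    rw [ENNReal.sum_eq_top]
    refine ⟨s, Finset.mem_univ s, ?_⟩
    have hk : KL (π s) (π' s) = ⊤ := by
      unfold KL
      rw [if_neg hcon]
    rw [hk]
    refine ENNReal.mul_top ?_
    have : 0 < ∑' t : ℕ, γ ^ t * stateDist π p p0 t s := pos_of_mul_pos_right hs hg.le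
    simpa using this
  have hdt : ∀ t s, 0 < stateDist π p p0 t s → 0 < stateDist π' p p0 t s := by
    intro t
    induction t with
    | zero => exact fun s h => h
    | succ t ih =>
      intro s' h
      simp only [stateDist] at h ⊢
      obtain ⟨s, _, hs⟩ := Finset.exists_ne_zero_of_sum_ne_zero h.ne'
      have hs1 := left_ne_zero_of_mul hs
      obtain ⟨a, _, ha⟩ := Finset.exists_ne_zero_of_sum_ne_zero (right_ne_zero_of_mul hs)
      have p1 : 0 < stateDist π p p0 t s := lt_of_le_of_ne ((hpm t).1 s) (Ne.symm hs1)
      have p2 : 0 < π s a := lt_of_le_of_ne ((hπ s).1 a) (Ne.symm (left_ne_zero_of_mul ha))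
      have p3 : 0 < p s a s' := lt_of_le_of_ne ((hp s a).1 s') (Ne.symm (right_ne_zero_of_mul ha))
      have q2 := hac s (aux_dDisc_pos γ hγ0 hγ1 p0 hp0 π hπ p hp s t p1) a p2
      have nn : ∀ s a, 0 ≤ π' s a * p s a s' := fun s a => mul_nonneg ((hπ' s).1 a) ((hp s a).1 s')
      refine Finset.sum_pos' (fun s _ => mul_nonneg ((hpm' t).1 s)
        (Finset.sum_nonneg fun a _ => nn s a)) ⟨s, Finset.mem_univ s, mul_pos (ih s p1) ?_⟩
      exact Finset.sum_pos' (fun a _ => nn s a) ⟨a, Finset.mem_univ a, mul_pos q2 p3⟩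
  have hd : ∀ s, 0 < dDisc γ π p p0 s → 0 < dDisc γ π' p p0 s := by
    intro s hs
    obtain ⟨t, ht⟩ := aux_exists γ p0 hp0 π hπ p hp s hs
    exact aux_dDisc_pos γ hγ0 hγ1 p0 hp0 π' hπ' p hp s t (hdt t s ht)
  have hreal := aux_real γ hγ0 hγ1 p0 hp0 π π' hπ hπ' p hp hd hac
  have hreal2 : ∑ z, rho γ π p p0 z * Real.log (rho γ π p p0 z / rho γ π' p p0 z) ≤
      ∑ s, (∑' t : ℕ, γ ^ t * stateDist π p p0 t s) *
        ∑ a, π s a * Real.log (π s a / π' s a) := by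
    refine le_of_mul_le_mul_left (hreal.trans (le_of_eq ?_)) hg
    rw [Finset.mul_sum]
    refine Finset.sum_congr rfl fun s _ => ?_
    simp only [dDisc]
    ring
  have hacr : ∀ z, 0 < rho γ π p p0 z → 0 < rho γ π' p p0 z := by
    intro z hz
    have h1 : 0 < dDisc γ π p p0 z.1 := pos_of_mul_pos_left hz ((hπ _).1 _)
    have h2 : 0 < π z.1 z.2 := pos_of_mul_pos_right hz h1.le
    exact mul_pos (hd _ h1) (hac _ h1 _ h2)
  unfold KL
  rw [if_pos hacr]
  refine (ENNReal.ofReal_le_ofReal hreal2).trans ((ofReal_sum_le' _ _).trans ?_)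
  refine Finset.sum_le_sum fun s _ => ?_
  rw [ENNReal.ofReal_mul (tsum_nonneg fun t => mul_nonneg (by positivity) ((hpm t).1 s))]
  exact mul_le_mul_right (ofReal_le_KL _ _) _
end
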